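/- Let a ≠ 0, H ∈ (0,1), μ ∈ ℝ, and assume ΔG^{(N)} ≠ 0. In the model with one nifBm, define the maximum likelihood estimator μ̂_N := ((ΔG^{(N)})ᵀ (Σ_H^{(N)})⁻¹ ΔY^{(N)}) / ((ΔG^{(N)})ᵀ (Σ_H^{(N)})⁻¹ ΔG^{(N)}). Then: (1) μ̂_N is unbiased and normally distributed, with variance a² / ((ΔG^{(N)})ᵀ (Σ_H^{(N)})⁻¹ ΔG^{(N)}); (2) if N^{H} / G(Nh) → 0 as N → ∞, then μ̂_N → μ both in L²(P) and almost surely. -/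

import Mathlib

open MeasureTheory ProbabilityTheory Filter Real Matrix Topology

noncomputable section

variable {Ω : Type*} [MeasurableSpace Ω]

/-- A (centered) fractional Brownian motion with Hurst index `H` on the probability space
`(Ω, P)`: a jointly measurable process with a.s. continuous sample paths, whose
finite-dimensional distributions are centered Gaussian (equivalently, every finite linear
combination of values of the process is a centered real Gaussian random variable), with
covariance `E[W_s W_t] = (s^{2H} + t^{2H} - |s-t|^{2H})/2` for `s, t ≥ 0`. -/
structure IsFBM (P : Measure Ω) (H : ℝ) (W : ℝ → Ω → ℝ) : Prop where
  jointMeasurable : Measurable (Function.uncurry W)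
  gaussian_fdd : ∀ (n : ℕ) (t : Fin n → ℝ), (∀ i, 0 ≤ t i) → ∀ c : Fin n → ℝ,
    ∃ v : NNReal, P.map (fun ω => ∑ i, c i * W (t i) ω) = gaussianReal 0 v
  cov : ∀ s t : ℝ, 0 ≤ s → 0 ≤ t →
    ∫ ω, W s ω * W t ω ∂P = (s ^ (2*H) + t ^ (2*H) - |s - t| ^ (2*H)) / 2
  cont : ∀ᵐ ω ∂P, Continuous fun t => W t ω

/-- The normalized integrated fractional Brownian motion (nifBm) with window `h`:
`X_t^{h,H} = (1/h) ∫_t^{t+h} W_u du`. -/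
def nifBm (W : ℝ → Ω → ℝ) (h t : ℝ) (ω : Ω) : ℝ := (1/h) * ∫ u in t..(t+h), W u ω

/-- The function `γ(H, n)`. -/
def gam (H : ℝ) (n : ℤ) : ℝ :=
  (|(n:ℝ) - 2| ^ (2*H+2) - 4 * |(n:ℝ) - 1| ^ (2*H+2) + 6 * |(n:ℝ)| ^ (2*H+2)
    - 4 * |(n:ℝ) + 1| ^ (2*H+2) + |(n:ℝ) + 2| ^ (2*H+2)) / (4 * (2*H+1) * (H+1))

/-- `log₊ x = log x` for `x > 0` and `0` otherwise. -/
def logpos (x : ℝ) : ℝ := if 0 < x then Real.log x else 0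

/-- Observations in the one-nifBm model: `Y_k^h = μ G(kh) + a X^{h,H}_{kh}`. -/
def Yobs1 (W : ℝ → Ω → ℝ) (a h μ : ℝ) (G : ℝ → ℝ) (k : ℕ) (ω : Ω) : ℝ :=
  μ * G ((k:ℝ)*h) + a * nifBm W h ((k:ℝ)*h) ω

/-- Increment vector `ΔY^{(N)}` in the one-nifBm model. -/
def deltaYvec1 (W : ℝ → Ω → ℝ) (a h μ : ℝ) (G : ℝ → ℝ) (N : ℕ) (ω : Ω) : Fin N → ℝ :=
  fun i => Yobs1 W a h μ G ((i:ℕ)+1) ω - Yobs1 W a h μ G (i:ℕ) ω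

/-- Increment vector `ΔG^{(N)}`. -/
def deltaGvec (G : ℝ → ℝ) (h : ℝ) (N : ℕ) : Fin N → ℝ :=
  fun i => G ((((i:ℕ):ℝ)+1)*h) - G (((i:ℕ):ℝ)*h)

/-- The matrix `Σ_H^{(N)}` with entries `h^{2H} γ(H,|i-j|)`, the covariance matrix of
`(ΔX^{h,H}_0, …, ΔX^{h,H}_{N-1})`. -/
def covMat1 (h H : ℝ) (N : ℕ) : Matrix (Fin N) (Fin N) ℝ :=
  Matrix.of fun i j => h ^ (2*H) * gam H |(i:ℤ) - (j:ℤ)|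

/-- The MLE `μ̂_N` of the drift parameter in the one-nifBm model. -/
def muHat1 (W : ℝ → Ω → ℝ) (a h H μ : ℝ) (G : ℝ → ℝ) (N : ℕ) (ω : Ω) : ℝ :=
  (deltaGvec G h N ⬝ᵥ ((covMat1 h H N)⁻¹ *ᵥ deltaYvec1 W a h μ G N ω)) /
  (deltaGvec G h N ⬝ᵥ ((covMat1 h H N)⁻¹ *ᵥ deltaGvec G h N))

/-- A centered Gaussian process on `ℕ` whose covariance is that of a process with orthogonal
increments has squares forming a submartingale. -/
lemma submartingale_sq_of_covariance {P : Measure Ω} [IsProbabilityMeasure P] {S : ℕ → Ω → ℝ}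
    (hS : IsGaussianProcess S P) (hmeas : ∀ n, StronglyMeasurable (S n))
    (hmean : ∀ n, ∫ ω, S n ω ∂P = 0) {v : ℕ → ℝ}
    (hcov : ∀ i j, i ≤ j → ∫ ω, S i ω * S j ω ∂P = v i) :
    Submartingale (fun n ω => S n ω ^ 2) (Filtration.natural S hmeas) P := by
  have hL2 : ∀ n, MemLp (S n) 2 P := fun n => (hS.hasGaussianLaw_eval n).memLp_two
  have hint : ∀ n, Integrable (S n) P := fun n => (hL2 n).integrable one_le_two
  have hadp : StronglyAdapted (Filtration.natural S hmeas) S :=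
    Filtration.stronglyAdapted_natural hmeas
  have hincr : ∀ i, P[S (i + 1) - S i | Filtration.natural S hmeas i] =ᵐ[P] 0 := by
    intro i
    have hjoint : IsGaussianProcess
        (Sum.elim (fun (_ : Unit) => S (i + 1) - S i) (fun j : Set.Iic i => S j)) P := by
      refine IsGaussianProcess.of_isGaussianProcess hS fun s => ?_
      rcases s with _ | j
      · refine ⟨{i, i + 1}, ContinuousLinearMap.proj ⟨i + 1, by simp⟩
          - ContinuousLinearMap.proj ⟨i, by simp⟩, fun ω => by simp⟩
      · exact ⟨{j.1}, ContinuousLinearMap.proj ⟨j.1, by simp⟩, fun ω => by simp⟩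
    have hind := hjoint.indepFun_of_covariance_eq_zero
      (fun _ => ((hmeas (i + 1)).sub (hmeas i)).measurable.aemeasurable)
      (fun j => (hmeas j).measurable.aemeasurable) (by
        rintro - ⟨j, hj⟩
        rw [covariance_eq_sub ((hL2 _).sub (hL2 _)) (hL2 _)]
        have : ∀ ω, ((S (i + 1) - S i) * S j) ω = S j ω * S (i + 1) ω - S j ω * S i ω := by
          intro ω; simp; ring
        simp only [this]
        rw [integral_sub (f := fun ω => S j ω * S (i + 1) ω) (g := fun ω => S j ω * S i ω)
          ((hL2 _).integrable_mul (hL2 _)) ((hL2 _).integrable_mul (hL2 _)),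
          hcov j _ (le_trans hj (Nat.le_succ i)), hcov j i hj, hmean j]
        simp)
    have hle : (Filtration.natural S hmeas i : MeasurableSpace Ω)
        ≤ MeasurableSpace.comap (fun ω (j : Set.Iic i) => S j ω) MeasurableSpace.pi := by
      refine iSup₂_le fun j hj => ?_
      rintro _ ⟨t, ht, rfl⟩
      exact ⟨(fun f : Set.Iic i → ℝ => f ⟨j, hj⟩) ⁻¹' t, measurable_pi_apply _ ht, rfl⟩
    have hind' : Indep (MeasurableSpace.comap (S (i + 1) - S i) inferInstance)
        (Filtration.natural S hmeas i) P := by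
      refine indep_of_indep_of_le_right ?_ hle
      refine indep_of_indep_of_le_left hind ?_
      rintro _ ⟨t, ht, rfl⟩
      exact ⟨(fun f : Unit → ℝ => f ()) ⁻¹' t, measurable_pi_apply _ ht, rfl⟩
    have hc := condExp_indep_eq
      (((hmeas (i + 1)).sub (hmeas i)).measurable.comap_le)
      ((Filtration.natural S hmeas).le i)
      (comap_measurable (S (i + 1) - S i)).stronglyMeasurable hind'
    filter_upwards [hc] with ω hω
    rw [hω]
    simp only [Pi.sub_apply, Pi.zero_apply]
    rw [integral_sub (hint _) (hint _), hmean, hmean, sub_zero]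
  refine submartingale_nat (fun n => (hadp n).pow 2) (fun n => (hL2 n).integrable_sq) fun i => ?_
  have hJ := (even_two.convexOn_pow (𝕜 := ℝ)).map_condExp_le_univ
    ((Filtration.natural S hmeas).le i) (continuous_pow 2).lowerSemicontinuous (hint (i + 1))
    (hL2 (i + 1)).integrable_sq
  have hS' : P[S i | Filtration.natural S hmeas i] = S i :=
    condExp_of_stronglyMeasurable ((Filtration.natural S hmeas).le i) (hadp i) (hint i)
  filter_upwards [hJ, hincr i,
    condExp_sub (hint (i + 1)) (hint i) (Filtration.natural S hmeas i)] with ω h1 h2 h3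
  rw [h2, hS'] at h3
  simp only [Pi.zero_apply, Pi.sub_apply] at h3
  have h4 : (P[S (i + 1) | Filtration.natural S hmeas i]) ω = S i ω := by linarith
  simp only [Function.comp_apply, h4] at h1
  exact h1

/-- A centered Gaussian sequence with `E[Mₙ Mₘ] = V (max n m)` and `V → 0` converges to `0`
almost surely. -/
lemma ae_tendsto_zero_of_covariance_max {P : Measure Ω} [IsProbabilityMeasure P]
    {M : ℕ → Ω → ℝ} (hM : IsGaussianProcess M P) (hmeas : ∀ n, StronglyMeasurable (M n))
    (hmean : ∀ n, ∫ ω, M n ω ∂P = 0) {V : ℕ → ℝ}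
    (hcov : ∀ i j, i ≤ j → ∫ ω, M i ω * M j ω ∂P = V j) (hV : Tendsto V atTop (𝓝 0)) :
    ∀ᵐ ω ∂P, Tendsto (fun n => M n ω) atTop (𝓝 0) := by
  have hfin : ∀ (ε : NNReal) (K L : ℕ), K ≤ L →
      ε * P {ω | ∃ n, K ≤ n ∧ n ≤ L ∧ (ε : ℝ) ≤ M n ω ^ 2} ≤ ENNReal.ofReal (V K) := by
    intro ε K L hKL
    have hsub := submartingale_sq_of_covariance (S := fun j => M (L - j))
      (hM.comp_right fun j => L - j) (fun n => hmeas _) (fun n => hmean _)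
      (v := fun j => V (L - j)) (fun i j hij => by
        rw [← hcov (L - j) (L - i) (by omega)]
        simp only [mul_comm])
    have hmax := maximal_ineq hsub (fun n ω => sq_nonneg _) (ε := ε) (L - K)
    refine le_trans (le_trans (mul_le_mul_right (measure_mono ?_) _) hmax) ?_
    · rintro ω ⟨n, hn1, hn2, hn3⟩
      simp only [Set.mem_ofPred_eq]
      rw [Finset.le_sup'_iff]
      refine ⟨L - n, by simp; omega, ?_⟩
      rwa [Nat.sub_sub_self hn2]
    · refine ENNReal.ofReal_le_ofReal ?_
      refine (setIntegral_le_integral (hsub.integrable _) (ae_of_all _ fun ω => sq_nonneg _)).trans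
        ?_
      rw [Nat.sub_sub_self hKL, ← hcov K K le_rfl]
      simp only [sq]; exact le_rfl
  have hinf : ∀ (ε : NNReal) (K : ℕ),
      ε * P {ω | ∃ n, K ≤ n ∧ (ε : ℝ) ≤ M n ω ^ 2} ≤ ENNReal.ofReal (V K) := by
    intro ε K
    have hU : {ω | ∃ n, K ≤ n ∧ (ε : ℝ) ≤ M n ω ^ 2}
        = ⋃ L, {ω | ∃ n, K ≤ n ∧ n ≤ K + L ∧ (ε : ℝ) ≤ M n ω ^ 2} := by
      ext ω
      simp only [Set.mem_ofPred_eq, Set.mem_iUnion]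
      exact ⟨fun ⟨n, h1, h2⟩ => ⟨n, n, h1, by omega, h2⟩, fun ⟨_, n, h1, _, h2⟩ => ⟨n, h1, h2⟩⟩
    have hmono : Monotone fun L => {ω | ∃ n, K ≤ n ∧ n ≤ K + L ∧ (ε : ℝ) ≤ M n ω ^ 2} :=
      fun a b hab ω ⟨n, h1, h2, h3⟩ => ⟨n, h1, by omega, h3⟩
    rw [hU, hmono.measure_iUnion, ENNReal.mul_iSup]
    exact iSup_le fun L => hfin ε K (K + L) (by omega)
  have hzero : ∀ ε : NNReal, 0 < ε →
      P {ω | ∀ K, ∃ n, K ≤ n ∧ (ε : ℝ) ≤ M n ω ^ 2} = 0 := by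
    intro ε hε
    have hlim : Tendsto (fun K => ENNReal.ofReal (V K)) atTop (𝓝 0) := by
      simpa using ENNReal.tendsto_ofReal hV
    have hle : ε * P {ω | ∀ K, ∃ n, K ≤ n ∧ (ε : ℝ) ≤ M n ω ^ 2} ≤ 0 :=
      ge_of_tendsto' hlim fun K =>
        (mul_le_mul_right (measure_mono (Set.ofPred_subset_ofPred.2 fun ω hω => hω K)) _).trans
          (hinf ε K)
    have h0 := nonpos_iff_eq_zero.1 hle
    rcases mul_eq_zero.1 h0 with h | h
    · exact absurd (ENNReal.coe_eq_zero.1 h) hε.ne'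
    · exact h
  have hall : ∀ᵐ ω ∂P, ∀ j : ℕ, ∃ K, ∀ n, K ≤ n → M n ω ^ 2 < 1 / ((j : ℝ) + 1) := by
    rw [ae_all_iff]
    intro j
    rw [ae_iff, ← hzero (1 / ((j : NNReal) + 1)) (by positivity)]
    congr 1
    ext ω
    simp
  filter_upwards [hall] with ω hω
  have hsq : Tendsto (fun n => M n ω ^ 2) atTop (𝓝 0) := by
    rw [Metric.tendsto_atTop]
    intro ε hε
    obtain ⟨j, hj⟩ := exists_nat_one_div_lt hε
    obtain ⟨K, hK⟩ := hω j
    refine ⟨K, fun n hn => ?_⟩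
    rw [Real.dist_eq, sub_zero, abs_of_nonneg (sq_nonneg _)]
    exact (hK n hn).trans hj
  rw [tendsto_zero_iff_abs_tendsto_zero]
  have := (Real.continuous_sqrt.tendsto 0).comp hsq
  simpa [Function.comp_def, Real.sqrt_sq_eq_abs] using this

/-- The Taylor remainder `cos u - 1 + u² / 2` against a homogeneous weight is integrable. -/
lemma integrableOn_cos_remainder_mul_rpow {p : ℝ} (hp2 : 2 < p) (hp4 : p < 4) :
    IntegrableOn (fun u : ℝ => (Real.cos u - 1 + u ^ 2 / 2) * u ^ (-p - 1)) (Set.Ioi 0) := by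
  have hcont : ContinuousOn (fun u : ℝ => (Real.cos u - 1 + u ^ 2 / 2) * u ^ (-p - 1))
      (Set.Ioi 0) := by
    refine ContinuousOn.mul (by fun_prop) ?_
    exact continuousOn_id.rpow_const fun x hx => Or.inl (ne_of_gt hx)
  rw [← Set.Ioc_union_Ioi_eq_Ioi (zero_le_one (α := ℝ)), integrableOn_union]
  constructor
  · have hb : IntegrableOn (fun u : ℝ => u ^ (3 - p)) (Set.Ioc 0 1) :=
      (intervalIntegrable_iff_integrableOn_Ioc_of_le zero_le_one).1
        (intervalIntegral.intervalIntegrable_rpow' (by linarith))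
    refine Integrable.mono' hb
      ((hcont.mono Set.Ioc_subset_Ioi_self).aestronglyMeasurable measurableSet_Ioc) ?_
    refine (ae_restrict_iff' measurableSet_Ioc).2 (ae_of_all _ fun u hu => ?_)
    have h1 := Real.cos_bound (x := u) (by rw [abs_of_pos hu.1]; exact hu.2)
    have h2 : |Real.cos u - 1 + u ^ 2 / 2| ≤ u ^ 4 := by
      rw [abs_of_pos hu.1] at h1
      rw [show Real.cos u - 1 + u ^ 2 / 2 = Real.cos u - (1 - u ^ 2 / 2) by ring]
      have : 0 ≤ u ^ 4 := by positivity
      linarith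
    rw [Real.norm_eq_abs, abs_mul, abs_of_nonneg (Real.rpow_nonneg hu.1.le _)]
    refine (mul_le_mul_of_nonneg_right h2 (Real.rpow_nonneg hu.1.le _)).trans_eq ?_
    rw [← Real.rpow_natCast u 4, ← Real.rpow_add hu.1]
    congr 1; push_cast; ring
  · have hb : IntegrableOn (fun u : ℝ => u ^ (1 - p)) (Set.Ioi 1) :=
      integrableOn_Ioi_rpow_of_lt (by linarith) one_pos
    refine Integrable.mono' hb
      ((hcont.mono (Set.Ioi_subset_Ioi zero_le_one)).aestronglyMeasurable measurableSet_Ioi) ?_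
    refine (ae_restrict_iff' measurableSet_Ioi).2 (ae_of_all _ fun u (hu : 1 < u) => ?_)
    have hu0 : 0 < u := by linarith
    have h2 : |Real.cos u - 1 + u ^ 2 / 2| ≤ u ^ 2 := by
      rw [abs_le]
      have := Real.cos_le_one u
      have := Real.one_sub_sq_div_two_le_cos (x := u)
      constructor <;> nlinarith
    rw [Real.norm_eq_abs, abs_mul, abs_of_nonneg (Real.rpow_nonneg hu0.le _)]
    refine (mul_le_mul_of_nonneg_right h2 (Real.rpow_nonneg hu0.le _)).trans_eq ?_
    rw [← Real.rpow_natCast u 2, ← Real.rpow_add hu0]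
    congr 1; push_cast; ring

lemma integral_cos_remainder_mul_rpow_pos {p : ℝ} (hp2 : 2 < p) (hp4 : p < 4) :
    0 < ∫ u in Set.Ioi (0 : ℝ), (Real.cos u - 1 + u ^ 2 / 2) * u ^ (-p - 1) := by
  have hpos : ∀ u ∈ Set.Ioi (0 : ℝ), 0 < (Real.cos u - 1 + u ^ 2 / 2) * u ^ (-p - 1) := by
    intro u hu
    refine mul_pos ?_ (Real.rpow_pos_of_pos hu _)
    have := Real.one_sub_sq_div_two_lt_cos (ne_of_gt hu)
    linarith
  rw [setIntegral_pos_iff_support_of_nonneg_ae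
    ((ae_restrict_iff' measurableSet_Ioi).2 (ae_of_all _ fun u hu => (hpos u hu).le))
    (integrableOn_cos_remainder_mul_rpow hp2 hp4)]
  have : Set.Ioi (0 : ℝ) ⊆ Function.support
      (fun u : ℝ => (Real.cos u - 1 + u ^ 2 / 2) * u ^ (-p - 1)) ∩ Set.Ioi 0 :=
    fun u hu => ⟨(hpos u hu).ne', hu⟩
  refine lt_of_lt_of_le ?_ (measure_mono this)
  simp

/-- Scaling the integral representation of `|x| ^ p`, `2 < p < 4`. -/
lemma integrableOn_and_integral_cos_remainder_comp_mul {p : ℝ} (hp2 : 2 < p) (hp4 : p < 4)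
    (x : ℝ) :
    IntegrableOn (fun u : ℝ => (Real.cos (x * u) - 1 + (x * u) ^ 2 / 2) * u ^ (-p - 1))
        (Set.Ioi 0) ∧
      ∫ u in Set.Ioi (0 : ℝ), (Real.cos (x * u) - 1 + (x * u) ^ 2 / 2) * u ^ (-p - 1)
        = |x| ^ p * ∫ u in Set.Ioi (0 : ℝ), (Real.cos u - 1 + u ^ 2 / 2) * u ^ (-p - 1) := by
  rcases eq_or_ne x 0 with rfl | hx
  · simp [Real.zero_rpow (by linarith : p ≠ 0)]
  have hx' : 0 < |x| := abs_pos.2 hx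
  have heq : Set.EqOn
      (fun u : ℝ => |x| ^ (p + 1) *
        ((Real.cos (|x| * u) - 1 + (|x| * u) ^ 2 / 2) * (|x| * u) ^ (-p - 1)))
      (fun u : ℝ => (Real.cos (x * u) - 1 + (x * u) ^ 2 / 2) * u ^ (-p - 1)) (Set.Ioi 0) := by
    intro u hu
    have hc : Real.cos (|x| * u) = Real.cos (x * u) := by
      rw [← Real.cos_abs (x * u), abs_mul, abs_of_pos (show 0 < u from hu)]
    have hr : |x| ^ (p + 1) * |x| ^ (-p - 1) = 1 := by
      rw [← Real.rpow_add hx']; simp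
    simp only
    rw [hc, mul_pow, sq_abs, ← mul_pow,
      Real.mul_rpow hx'.le (show (0 : ℝ) ≤ u from le_of_lt hu)]
    linear_combination (Real.cos (x * u) - 1 + (x * u) ^ 2 / 2) * u ^ (-p - 1) * hr
  constructor
  · refine IntegrableOn.congr_fun ?_ heq measurableSet_Ioi
    refine Integrable.const_mul ?_ _
    have := (integrableOn_Ioi_comp_mul_left_iff
      (fun u : ℝ => (Real.cos u - 1 + u ^ 2 / 2) * u ^ (-p - 1)) 0 hx').2
      (by simpa using integrableOn_cos_remainder_mul_rpow hp2 hp4)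
    exact this
  · rw [← setIntegral_congr_fun measurableSet_Ioi heq, integral_const_mul,
      integral_comp_mul_left_Ioi (fun u : ℝ => (Real.cos u - 1 + u ^ 2 / 2) * u ^ (-p - 1)) 0 hx',
      mul_zero, smul_eq_mul, ← mul_assoc, Real.rpow_add_one hx'.ne', mul_inv_cancel_right₀ hx'.ne']

/-- Spectral representation of `γ(H, ·)`. -/
lemma exists_gam_eq_integral {H : ℝ} (hH : H ∈ Set.Ioo (0 : ℝ) 1) :
    ∃ K : ℝ, 0 < K ∧ ∀ n : ℤ,
      IntegrableOn (fun u : ℝ => ((2 - 2 * Real.cos u) ^ 2 * u ^ (-(2 * H + 2) - 1))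
        * Real.cos (n * u)) (Set.Ioi 0) ∧
      gam H n = K * ∫ u in Set.Ioi (0 : ℝ),
        ((2 - 2 * Real.cos u) ^ 2 * u ^ (-(2 * H + 2) - 1)) * Real.cos (n * u) := by
  obtain ⟨hH0, hH1⟩ := hH
  have hp2 : 2 < 2 * H + 2 := by linarith
  have hp4 : 2 * H + 2 < 4 := by linarith
  set C := ∫ u in Set.Ioi (0 : ℝ), (Real.cos u - 1 + u ^ 2 / 2) * u ^ (-(2 * H + 2) - 1) with hC
  have hCpos : 0 < C := integral_cos_remainder_mul_rpow_pos hp2 hp4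
  refine ⟨(C * (4 * (2 * H + 1) * (H + 1)))⁻¹, by positivity, fun n => ?_⟩
  let f : ℝ → ℝ → ℝ := fun x u =>
    (Real.cos (x * u) - 1 + (x * u) ^ 2 / 2) * u ^ (-(2 * H + 2) - 1)
  have hf : ∀ x, IntegrableOn (f x) (Set.Ioi 0) ∧ ∫ u in Set.Ioi (0 : ℝ), f x u
      = |x| ^ (2 * H + 2) * C :=
    fun x => integrableOn_and_integral_cos_remainder_comp_mul hp2 hp4 x
  have hdiff : (fun u : ℝ => ((2 - 2 * Real.cos u) ^ 2 * u ^ (-(2 * H + 2) - 1))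
      * Real.cos (n * u)) = fun u => f (n - 2) u - 4 * f (n - 1) u + 6 * f n u
        - 4 * f (n + 1) u + f (n + 2) u := by
    funext u
    have e1 : ((n : ℝ) - 2) * u = n * u - 2 * u := by ring
    have e2 : ((n : ℝ) + 2) * u = n * u + 2 * u := by ring
    have e3 : ((n : ℝ) - 1) * u = n * u - u := by ring
    have e4 : ((n : ℝ) + 1) * u = n * u + u := by ring
    simp only [f, e1, e2, e3, e4, Real.cos_add, Real.cos_sub, Real.cos_two_mul]
    ring
  have i1 := (hf (n - 2)).1
  have i2 := (hf (n - 1)).1.const_mul 4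
  have i3 := (hf n).1.const_mul 6
  have i4 := (hf (n + 1)).1.const_mul 4
  have i5 := (hf (n + 2)).1
  rw [hdiff]
  refine ⟨(((i1.sub i2).add i3).sub i4).add i5, ?_⟩
  have hI := integral_add (((i1.sub i2).add i3).sub i4) i5
  rw [integral_sub' ((i1.sub i2).add i3) i4, integral_add' (i1.sub i2) i3,
    integral_sub' i1 i2] at hI
  refine (Eq.trans ?_ (congrArg (_ * ·) hI.symm))
  rw [integral_const_mul, integral_const_mul,
    integral_const_mul, (hf _).2, (hf _).2, (hf _).2, (hf _).2, (hf _).2, gam]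
  field_simp

/-- A nonzero real trigonometric sum is nonzero somewhere on `(0, π)`. -/
lemma exists_trig_sum_ne_zero {N : ℕ} {x : Fin N → ℝ} (hx : x ≠ 0) :
    ∃ u ∈ Set.Ioo 0 π,
      (∑ i, x i * Real.cos (i * u)) ^ 2 + (∑ i, x i * Real.sin (i * u)) ^ 2 ≠ 0 := by
  by_contra! hcon
  let p : Polynomial ℂ := ∑ i : Fin N, Polynomial.C (x i : ℂ) * Polynomial.X ^ (i : ℕ)
  have hroot : ∀ u ∈ Set.Ioo 0 π, p.eval (Complex.exp (u * Complex.I)) = 0 := by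
    intro u hu
    have h0 := hcon u hu
    have hc : ∑ i, x i * Real.cos (i * u) = 0 := by
      nlinarith [sq_nonneg (∑ i, x i * Real.cos (i * u)),
        sq_nonneg (∑ i, x i * Real.sin (i * u))]
    have hs : ∑ i, x i * Real.sin (i * u) = 0 := by
      nlinarith [sq_nonneg (∑ i, x i * Real.cos (i * u)),
        sq_nonneg (∑ i, x i * Real.sin (i * u))]
    have : p.eval (Complex.exp (u * Complex.I))
        = ((∑ i, x i * Real.cos (i * u) : ℝ) : ℂ)
          + ((∑ i, x i * Real.sin (i * u) : ℝ) : ℂ) * Complex.I := by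
      simp only [p, Polynomial.eval_finsetSum, Polynomial.eval_mul, Polynomial.eval_C,
        Polynomial.eval_pow, Polynomial.eval_X]
      push_cast
      rw [Finset.sum_mul, ← Finset.sum_add_distrib]
      refine Finset.sum_congr rfl fun i _ => ?_
      rw [← Complex.exp_nat_mul, ← mul_assoc, Complex.exp_mul_I]
      ring
    rw [this, hc, hs]; simp
  have hinj : Set.InjOn (fun u : ℝ => Complex.exp (u * Complex.I)) (Set.Ioo 0 π) := by
    intro u hu v hv huv
    have h := congrArg Complex.re huv
    simp only [Complex.exp_ofReal_mul_I_re] at h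
    exact Real.injOn_cos ⟨hu.1.le, hu.2.le⟩ ⟨hv.1.le, hv.2.le⟩ h
  have hp : p = 0 := by
    refine Polynomial.eq_zero_of_infinite_isRoot p ?_
    refine Set.Infinite.mono ?_ ((Set.Ioo_infinite Real.pi_pos).image hinj)
    rintro _ ⟨u, hu, rfl⟩
    exact hroot u hu
  refine hx (funext fun i => ?_)
  have := congrArg (fun q => Polynomial.coeff q (i : ℕ)) hp
  simpa [p, Polynomial.finsetSum_coeff, Polynomial.coeff_C_mul, Polynomial.coeff_X_pow,
    Fin.val_inj] using this

/-- The covariance matrix of the nifBm increments is positive definite. -/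
lemma covMat1_posDef {h H : ℝ} (hh : 0 < h) (hH : H ∈ Set.Ioo (0 : ℝ) 1) (N : ℕ) :
    (covMat1 h H N).PosDef := by
  obtain ⟨K, hK, hgam⟩ := exists_gam_eq_integral hH
  refine PosDef.of_dotProduct_mulVec_pos ?_ fun x hx => ?_
  · ext i j
    simp only [covMat1, conjTranspose_apply, of_apply, star_trivial]
    rw [abs_sub_comm]
  let w : ℝ → ℝ := fun u => (2 - 2 * Real.cos u) ^ 2 * u ^ (-(2 * H + 2) - 1)
  let F : ℝ → ℝ := fun u => w u *
    ((∑ i, x i * Real.cos (i * u)) ^ 2 + (∑ i, x i * Real.sin (i * u)) ^ 2)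
  have hFsum : F = fun u => ∑ i, ∑ j, x i * x j *
      (w u * Real.cos ((|(i : ℤ) - (j : ℤ)| : ℤ) * u)) := by
    funext u
    have hcos : ∀ i j : Fin N, Real.cos ((|(i : ℤ) - (j : ℤ)| : ℤ) * u)
        = Real.cos (i * u) * Real.cos (j * u) + Real.sin (i * u) * Real.sin (j * u) := by
      intro i j
      rw [← Real.cos_sub, ← sub_mul]
      rcases abs_choice ((i : ℤ) - (j : ℤ)) with h | h <;> rw [h]
      · push_cast; rfl
      · rw [← Real.cos_neg]; push_cast; ring_nf
    simp only [F, hcos, sq]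
    rw [Finset.sum_mul_sum, Finset.sum_mul_sum, ← Finset.sum_add_distrib, Finset.mul_sum]
    refine Finset.sum_congr rfl fun i _ => ?_
    rw [← Finset.sum_add_distrib, Finset.mul_sum]
    refine Finset.sum_congr rfl fun j _ => ?_
    ring
  have hint : ∀ i j : Fin N, IntegrableOn (fun u => x i * x j *
      (w u * Real.cos ((|(i : ℤ) - (j : ℤ)| : ℤ) * u))) (Set.Ioi 0) :=
    fun i j => (hgam _).1.const_mul _
  have hFint : IntegrableOn F (Set.Ioi 0) := by
    rw [hFsum]
    exact integrable_finsetSum _ fun i _ => integrable_finsetSum _ fun j _ => hint i j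
  have hquad : star x ⬝ᵥ covMat1 h H N *ᵥ x
      = h ^ (2 * H) * K * ∫ u in Set.Ioi (0 : ℝ), F u := by
    rw [hFsum, integral_finsetSum _ fun i _ => integrable_finsetSum _ fun j _ => hint i j]
    simp only [star_trivial, dotProduct, mulVec, Finset.mul_sum]
    refine Finset.sum_congr rfl fun i _ => ?_
    rw [integral_finsetSum _ fun j _ => hint i j, Finset.mul_sum]
    refine Finset.sum_congr rfl fun j _ => ?_
    rw [integral_const_mul, covMat1, of_apply, (hgam _).2]
    ring
  have hFnn : ∀ u ∈ Set.Ioi (0 : ℝ), 0 ≤ F u := fun u hu =>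
    mul_nonneg (mul_nonneg (sq_nonneg _) (Real.rpow_nonneg (le_of_lt hu) _)) (by positivity)
  rw [hquad]
  refine mul_pos (mul_pos (Real.rpow_pos_of_pos hh _) hK) ?_
  rw [setIntegral_pos_iff_support_of_nonneg_ae
    ((ae_restrict_iff' measurableSet_Ioi).2 (ae_of_all _ hFnn)) hFint]
  obtain ⟨u, hu, hne⟩ := exists_trig_sum_ne_zero hx
  have hopen : IsOpen (Set.Ioi 0 ∩ F ⁻¹' {0}ᶜ) := by
    refine ContinuousOn.isOpen_inter_preimage ?_ isOpen_Ioi isOpen_compl_singleton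
    refine ContinuousOn.mul (ContinuousOn.mul (by fun_prop) ?_) (by fun_prop)
    exact continuousOn_id.rpow_const fun x hx => Or.inl (ne_of_gt hx)
  have hcos : Real.cos u < 1 := by
    have := Real.cos_lt_cos_of_nonneg_of_le_pi le_rfl hu.2.le hu.1
    rwa [Real.cos_zero] at this
  have hFu : F u ≠ 0 :=
    mul_ne_zero (mul_ne_zero (pow_ne_zero 2 (by linarith)) (Real.rpow_pos_of_pos hu.1 _).ne') hne
  have hpos := hopen.measure_pos volume ⟨u, hu.1, hFu⟩
  rwa [Set.inter_comm] at hpos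

/-- An almost sure limit of centered real Gaussian variables is a centered Gaussian variable. -/
lemma exists_map_eq_gaussianReal_of_tendsto {P : Measure Ω} [IsProbabilityMeasure P]
    {Y : ℕ → Ω → ℝ} {X : Ω → ℝ} (hY : ∀ n, AEMeasurable (Y n) P)
    (hlaw : ∀ n, ∃ v : NNReal, P.map (Y n) = gaussianReal 0 v)
    (hlim : ∀ᵐ ω ∂P, Tendsto (fun n => Y n ω) atTop (𝓝 (X ω))) :
    ∃ v : NNReal, P.map X = gaussianReal 0 v := by
  have hX : AEMeasurable X P := aemeasurable_of_tendsto_metrizable_ae atTop hY hlim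
  have : IsProbabilityMeasure (P.map X) := Measure.isProbabilityMeasure_map hX
  choose v hv using hlaw
  have hφn : ∀ n t, charFun (P.map (Y n)) t = Real.exp (-(v n * t ^ 2 / 2)) := by
    intro n t
    rw [hv, charFun_gaussianReal]
    push_cast
    congr 1
    ring
  have hφ : ∀ t, Tendsto (fun n => charFun (P.map (Y n)) t) atTop (𝓝 (charFun (P.map X) t)) := by
    intro t
    have hm : AEStronglyMeasurable (fun x : ℝ => Complex.exp (t * x * Complex.I)) (P.map X) :=
      (by fun_prop : Continuous fun x : ℝ =>
        Complex.exp (t * x * Complex.I)).aestronglyMeasurable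
    have hmn : ∀ n, AEStronglyMeasurable (fun x : ℝ => Complex.exp (t * x * Complex.I))
        (P.map (Y n)) := fun n => (by fun_prop : Continuous fun x : ℝ =>
        Complex.exp (t * x * Complex.I)).aestronglyMeasurable
    simp only [charFun_apply_real]
    rw [integral_map hX hm]
    simp only [fun n => integral_map (hY n) (hmn n)]
    refine tendsto_integral_of_dominated_convergence (fun _ => 1)
      (fun n => (hmn n).comp_aemeasurable (hY n)) (integrable_const _)
      (fun n => ae_of_all _ fun ω => ?_) ?_
    · rw [← Complex.ofReal_mul, Complex.norm_exp_ofReal_mul_I]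
    · filter_upwards [hlim] with ω hω
      exact (((by fun_prop : Continuous fun x : ℝ =>
        Complex.exp (t * x * Complex.I)).tendsto (X ω)).comp hω)
  obtain ⟨t₀, ht₀, hne⟩ : ∃ t₀ : ℝ, 0 < t₀ ∧ charFun (P.map X) t₀ ≠ 0 := by
    have h0 : charFun (P.map X) 0 ≠ 0 := by simp
    have hev := (continuous_charFun (μ := P.map X)).continuousAt.eventually_ne h0
    obtain ⟨ε, hε, hball⟩ := Metric.eventually_nhds_iff.1 hev
    refine ⟨ε / 2, by positivity, hball ?_⟩
    rw [Real.dist_eq, sub_zero, abs_of_pos (by positivity)]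
    linarith
  have hlog : Tendsto (fun n => -(v n * t₀ ^ 2 / 2)) atTop
      (𝓝 (Real.log ‖charFun (P.map X) t₀‖)) := by
    have h1 := ((Real.continuousAt_log (norm_ne_zero_iff.2 hne)).tendsto).comp (hφ t₀).norm
    refine h1.congr fun n => ?_
    simp only [Function.comp_apply, hφn]
    rw [Complex.norm_real, Real.norm_eq_abs, Real.abs_exp, Real.log_exp]
  obtain ⟨w, hw⟩ : ∃ w : ℝ, Tendsto (fun n => (v n : ℝ)) atTop (𝓝 w) := by
    refine ⟨_, (hlog.mul_const (-2 / t₀ ^ 2)).congr fun n => ?_⟩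
    field_simp
  have hw0 : 0 ≤ w := ge_of_tendsto' hw fun n => (v n).2
  lift w to NNReal using hw0
  refine ⟨w, Measure.ext_of_charFun (funext fun t => ?_)⟩
  refine tendsto_nhds_unique (hφ t) ?_
  have h2 : charFun (gaussianReal 0 w) t = Real.exp (-(w * t ^ 2 / 2)) := by
    rw [charFun_gaussianReal]
    push_cast
    congr 1
    ring
  rw [h2]
  simp only [hφn]
  refine (Complex.continuous_ofReal.tendsto _).comp ((Real.continuous_exp.tendsto _).comp ?_)
  exact ((hw.mul_const _).div_const _).neg

/-- A process is centered Gaussian as soon as all its finite linear combinations are. -/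
lemma isGaussianProcess_of_linear_combination {T : Type*} {P : Measure Ω}
    {X : T → Ω → ℝ} (hX : ∀ t, AEMeasurable (X t) P)
    (hlaw : ∀ (I : Finset T) (c : I → ℝ), ∃ v : NNReal,
      P.map (fun ω => ∑ i, c i * X i ω) = gaussianReal 0 v) :
    IsGaussianProcess X P := by
  refine ⟨fun I => ⟨isGaussian_of_map_eq_gaussianReal fun L => ?_⟩⟩
  classical
  obtain ⟨v, hv⟩ := hlaw I fun i => L (Pi.single i 1)
  refine ⟨0, v, ?_⟩
  rw [← hv, AEMeasurable.map_map_of_aemeasurable (by fun_prop)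
    (aemeasurable_pi_lambda (fun ω => I.restrict fun x => X x ω) fun i => hX i)]
  congr 1
  funext ω
  simp only [Function.comp_apply]
  conv_lhs => rw [← Finset.univ_sum_single (I.restrict fun x => X x ω)]
  rw [map_sum]
  refine Finset.sum_congr rfl fun i _ => ?_
  have : Pi.single i (I.restrict (fun x => X x ω) i)
      = X i ω • (Pi.single i 1 : I → ℝ) := by
    rw [← Pi.single_smul]; simp
  rw [this, map_smul, smul_eq_mul, mul_comm]

/-- An almost sure pointwise limit of centered Gaussian processes is Gaussian. -/
lemma isGaussianProcess_of_tendsto {T : Type*} {P : Measure Ω} [IsProbabilityMeasure P]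
    {Y : ℕ → T → Ω → ℝ} {X : T → Ω → ℝ} (hY : ∀ n, IsGaussianProcess (Y n) P)
    (hmean : ∀ n t, ∫ ω, Y n t ω ∂P = 0)
    (hlim : ∀ t, ∀ᵐ ω ∂P, Tendsto (fun n => Y n t ω) atTop (𝓝 (X t ω))) :
    IsGaussianProcess X P ∧ ∀ t, ∫ ω, X t ω ∂P = 0 := by
  have hcomb : ∀ (I : Finset T) (c : I → ℝ), ∃ v : NNReal,
      P.map (fun ω => ∑ i, c i * X i ω) = gaussianReal 0 v := by
    intro I c
    refine exists_map_eq_gaussianReal_of_tendsto (Y := fun n ω => ∑ i, c i * Y n i ω)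
      (fun n => ?_) (fun n => ?_) ?_
    · exact Finset.aemeasurable_fun_sum _ fun i _ => ((hY n).aemeasurable i).const_mul _
    · have hG : HasGaussianLaw (fun ω => ∑ i, c i * Y n i ω) P := by
        have := ((hY n).hasGaussianLaw I).map_fun
          (∑ i, c i • (ContinuousLinearMap.proj i : (I → ℝ) →L[ℝ] ℝ))
        simpa using this
      have h0 : ∫ ω, ∑ i, c i * Y n i ω ∂P = 0 := by
        have hi : ∀ i : I, Integrable (fun ω => c i * Y n i ω) P := fun i =>
          ((hY n).hasGaussianLaw_eval (i : T)).integrable.const_mul _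
        rw [integral_finsetSum _ fun i _ => hi i]
        simp [integral_const_mul, hmean]
      exact ⟨_, by rw [hG.map_eq_gaussianReal, h0]⟩
    · have : ∀ᵐ ω ∂P, ∀ i : I, Tendsto (fun n => Y n i ω) atTop (𝓝 (X i ω)) :=
        ae_all_iff.2 fun i => hlim i
      filter_upwards [this] with ω hω
      exact tendsto_finsetSum _ fun i _ => (hω i).const_mul _
  have hX : ∀ t, AEMeasurable (X t) P := fun t =>
    aemeasurable_of_tendsto_metrizable_ae atTop (fun n => (hY n).aemeasurable t) (hlim t)
  refine ⟨isGaussianProcess_of_linear_combination hX hcomb, fun t => ?_⟩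
  obtain ⟨v, hv⟩ := hcomb {t} fun _ => 1
  simp only [Finset.univ_unique, one_mul, Finset.sum_singleton] at hv
  change P.map (X t) = _ at hv
  rw [← integral_id_gaussianReal (μ := 0) (v := v), ← hv, integral_map (hX t) (by fun_prop)]

/-- Left Riemann sums of a continuous function converge to its mean. -/
lemma tendsto_riemann_sum {f : ℝ → ℝ} (hf : Continuous f) (t : ℝ) {h : ℝ} (hh : 0 < h) :
    Tendsto (fun n : ℕ => (1 / ((n : ℝ) + 1)) * ∑ k : Fin (n + 1), f (t + k * (h / (n + 1))))
      atTop (𝓝 ((1 / h) * ∫ u in t..(t + h), f u)) := by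
  have huc : UniformContinuousOn f (Set.Icc t (t + h)) :=
    isCompact_Icc.uniformContinuousOn_of_continuous hf.continuousOn
  rw [Metric.tendsto_atTop]
  intro ε hε
  obtain ⟨δ, hδ, huc⟩ := Metric.uniformContinuousOn_iff_le.1 huc (ε / 2) (by positivity)
  obtain ⟨n₀, hn₀⟩ := exists_nat_gt (h / δ)
  refine ⟨n₀, fun n hn => ?_⟩
  have hn1 : (0 : ℝ) < n + 1 := by positivity
  set d := h / ((n : ℝ) + 1) with hd
  have hd0 : 0 < d := by positivity
  have hdδ : d ≤ δ := by
    rw [hd, div_le_iff₀ hn1]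
    rw [div_lt_iff₀ hδ] at hn₀
    have : (n₀ : ℝ) ≤ n := by exact_mod_cast hn
    nlinarith
  have hdn : ((n : ℝ) + 1) * d = h := by rw [hd]; field_simp
  have hsplit : ∫ u in t..(t + h), f u
      = ∑ k ∈ Finset.range (n + 1), ∫ u in (t + k * d)..(t + (k + 1 : ℕ) * d), f u := by
    rw [intervalIntegral.sum_integral_adjacent_intervals (a := fun k : ℕ => t + k * d)
      fun k _ => hf.intervalIntegrable _ _]
    push_cast
    rw [hdn]; simp
  have hpiece : ∀ k ∈ Finset.range (n + 1),
      ‖d * f (t + k * d) - ∫ u in (t + k * d)..(t + (k + 1 : ℕ) * d), f u‖ ≤ ε / 2 * d := by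
    intro k hk
    have hkn : (k : ℝ) + 1 ≤ n + 1 := by exact_mod_cast Finset.mem_range.1 hk
    have hlen : t + (k + 1 : ℕ) * d - (t + k * d) = d := by push_cast; ring
    have hc : d * f (t + k * d)
        = ∫ _ in (t + k * d)..(t + (k + 1 : ℕ) * d), f (t + k * d) := by
      rw [intervalIntegral.integral_const, hlen, smul_eq_mul]
    rw [hc, ← intervalIntegral.integral_sub (by simp) (hf.intervalIntegrable _ _)]
    refine (intervalIntegral.norm_integral_le_of_norm_le_const (C := ε / 2) fun u hu => ?_).trans ?_
    · rw [Set.uIoc_of_le (by linarith)] at hu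
      have hk0 : 0 ≤ (k : ℝ) * d := by positivity
      have hk1 : ((k : ℝ) + 1) * d ≤ h := by
        rw [← hdn]; exact mul_le_mul_of_nonneg_right hkn hd0.le
      have hu1 := hu.1
      have hu2 := hu.2
      push_cast at hu2
      rw [← dist_eq_norm]
      refine huc _ ⟨by linarith, by linarith⟩ _ ⟨by linarith, by linarith⟩ ?_
      rw [Real.dist_eq, abs_le]
      constructor <;> linarith
    · rw [hlen, abs_of_pos hd0]
  have hdiff : (1 / ((n : ℝ) + 1)) * ∑ k : Fin (n + 1), f (t + k * d)
      - (1 / h) * ∫ u in t..(t + h), f u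
      = (1 / h) * ∑ k ∈ Finset.range (n + 1),
        (d * f (t + k * d) - ∫ u in (t + k * d)..(t + (k + 1 : ℕ) * d), f u) := by
    have hcoef : 1 / h * d = 1 / ((n : ℝ) + 1) := by rw [hd]; field_simp
    rw [hsplit, Finset.sum_sub_distrib, mul_sub, ← Finset.mul_sum, ← mul_assoc, hcoef,
      Fin.sum_univ_eq_sum_range (fun k => f (t + k * d))]
  rw [dist_eq_norm, hdiff, norm_mul, Real.norm_of_nonneg (by positivity : 0 ≤ 1 / h)]
  have hsum := (norm_sum_le _ _).trans (Finset.sum_le_sum hpiece)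
  rw [Finset.sum_const, Finset.card_range, nsmul_eq_mul] at hsum
  have : ((n + 1 : ℕ) : ℝ) * (ε / 2 * d) = ε / 2 * h := by rw [← hdn]; push_cast; ring
  rw [this] at hsum
  calc _ ≤ 1 / h * (ε / 2 * h) := mul_le_mul_of_nonneg_left hsum (by positivity)
    _ = ε / 2 := by field_simp
    _ < ε := by linarith

namespace IsFBM

variable {P : Measure Ω} {H : ℝ} {W : ℝ → Ω → ℝ}

lemma measurable (hW : IsFBM P H W) (t : ℝ) : Measurable (W t) :=
  hW.jointMeasurable.comp measurable_prodMk_left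

lemma isGaussianProcess (hW : IsFBM P H W) :
    IsGaussianProcess (fun t : NNReal => W t) P := by
  refine isGaussianProcess_of_linear_combination
    (fun t => (hW.measurable t).aemeasurable) fun I c => ?_
  obtain ⟨v, hv⟩ := hW.gaussian_fdd _ (fun i => ((I.equivFin.symm i : NNReal) : ℝ))
    (fun i => NNReal.coe_nonneg _) (fun i => c (I.equivFin.symm i))
  refine ⟨v, hv ▸ ?_⟩
  congr 1
  funext ω
  exact (Equiv.sum_comp I.equivFin.symm fun i => c i * W (i : NNReal) ω).symm

lemma integral_eq_zero (hW : IsFBM P H W) {t : ℝ} (ht : 0 ≤ t) : ∫ ω, W t ω ∂P = 0 := by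
  obtain ⟨v, hv⟩ := hW.gaussian_fdd 1 (fun _ => t) (fun _ => ht) (fun _ => 1)
  simp only [Finset.univ_unique, one_mul, Finset.sum_singleton] at hv
  change P.map (W t) = _ at hv
  rw [← integral_id_gaussianReal (μ := 0) (v := v), ← hv,
    integral_map (hW.measurable t).aemeasurable (by fun_prop)]

lemma memLp_two (hW : IsFBM P H W) {t : ℝ} (ht : 0 ≤ t) : MemLp (W t) 2 P :=
  (hW.isGaussianProcess.hasGaussianLaw_eval ⟨t, ht⟩).memLp_two

lemma stronglyMeasurable_nifBm (hW : IsFBM P H W) (h t : ℝ) :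
    StronglyMeasurable (nifBm W h t) := by
  have hsm : StronglyMeasurable fun ω => ∫ u in Set.uIoc t (t + h), W u ω :=
    StronglyMeasurable.integral_prod_right'
      (f := fun p : Ω × ℝ => W p.2 p.1)
      (hW.jointMeasurable.comp measurable_swap).stronglyMeasurable
  unfold nifBm
  simp only [intervalIntegral.intervalIntegral_eq_integral_uIoc]
  exact (hsm.const_smul (if t ≤ t + h then (1 : ℝ) else -1)).const_mul _

/-- The normalized integrated fractional Brownian motion is a centered Gaussian process. -/
lemma isGaussianProcess_nifBm [IsProbabilityMeasure P] (hW : IsFBM P H W) {h : ℝ} (hh : 0 < h) :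
    IsGaussianProcess (fun t : NNReal => nifBm W h t) P ∧
      ∀ t : NNReal, ∫ ω, nifBm W h t ω ∂P = 0 := by
  let τ : ℕ → NNReal → ℕ → NNReal := fun n t k => t + k * (⟨h, hh.le⟩ / (n + 1))
  have hτ : ∀ n t k, (τ n t k : ℝ) = t + k * (h / (n + 1)) := fun n t k => by
    simp only [τ, NNReal.coe_add, NNReal.coe_mul, NNReal.coe_natCast]
    rfl
  refine isGaussianProcess_of_tendsto
    (Y := fun n t ω => (1 / ((n : ℝ) + 1)) * ∑ k : Fin (n + 1), W (τ n t k) ω)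
    (fun n => ?_) (fun n t => ?_) fun t => ?_
  · refine IsGaussianProcess.of_isGaussianProcess hW.isGaussianProcess fun t => ?_
    classical
    refine ⟨Finset.univ.image fun k : Fin (n + 1) => τ n t k,
      (1 / ((n : ℝ) + 1)) • ∑ k : Fin (n + 1), ContinuousLinearMap.proj
        ⟨τ n t k, Finset.mem_image_of_mem _ (Finset.mem_univ k)⟩, fun ω => ?_⟩
    simp
  · rw [integral_const_mul, integral_finsetSum _ fun k _ =>
      (hW.memLp_two (NNReal.coe_nonneg _)).integrable one_le_two]
    simp [hW.integral_eq_zero]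
  · filter_upwards [hW.cont] with ω hω
    simp only [hτ]
    exact tendsto_riemann_sum hω t hh

end IsFBM

lemma hasDerivAt_abs_rpow_mul_self {p : ℝ} (hp : 0 < p) (x : ℝ) :
    HasDerivAt (fun x : ℝ => |x| ^ p * x) ((p + 1) * |x| ^ p) x := by
  rcases lt_trichotomy x 0 with hx | rfl | hx
  · have h1 : HasDerivAt (fun y : ℝ => -((-y) ^ (p + 1))) ((p + 1) * |x| ^ p) x := by
      have := ((hasDerivAt_neg x).rpow_const (p := p + 1) (Or.inl (by simpa using hx.ne))).neg
      refine this.congr_deriv ?_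
      rw [abs_of_neg hx]; ring_nf
    refine h1.congr_of_eventuallyEq ?_
    filter_upwards [gt_mem_nhds hx] with y hy
    rw [abs_of_neg hy, Real.rpow_add_one (by linarith)]
    ring
  · rw [hasDerivAt_iff_tendsto_slope]
    have hc : Tendsto (fun x : ℝ => |x| ^ p) (𝓝[≠] 0) (𝓝 ((p + 1) * |0| ^ p)) := by
      have : Continuous fun x : ℝ => |x| ^ p := continuous_abs.rpow_const fun _ => Or.inr hp.le
      convert (this.tendsto 0).mono_left nhdsWithin_le_nhds using 2
      simp [Real.zero_rpow hp.ne']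
    refine hc.congr' ?_
    filter_upwards [self_mem_nhdsWithin] with y hy
    have hy : y ≠ 0 := hy
    simp [slope_def_field, hy]
  · have h1 : HasDerivAt (fun y : ℝ => y ^ (p + 1)) ((p + 1) * |x| ^ p) x := by
      have := Real.hasDerivAt_rpow_const (x := x) (p := p + 1) (Or.inl hx.ne')
      refine this.congr_deriv ?_
      rw [abs_of_pos hx]; ring_nf
    refine h1.congr_of_eventuallyEq ?_
    filter_upwards [lt_mem_nhds hx] with y hy
    rw [abs_of_pos hy, Real.rpow_add_one (by linarith)]

/-- Integral of `|u - v| ^ p` over two windows of equal length. -/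
lemma integral_integral_abs_sub_rpow {p : ℝ} (hp : 0 < p) (s t h : ℝ) :
    ∫ u in s..(s + h), ∫ v in t..(t + h), |u - v| ^ p
      = (|s - t + h| ^ (p + 2) - 2 * |s - t| ^ (p + 2) + |s - t - h| ^ (p + 2))
        / ((p + 1) * (p + 2)) := by
  have hc : Continuous fun x : ℝ => |x| ^ p := continuous_abs.rpow_const fun _ => Or.inr hp.le
  have hinner : ∀ u, ∫ v in t..(t + h), |u - v| ^ p
      = (|u - t| ^ p * (u - t) - |u - (t + h)| ^ p * (u - (t + h))) / (p + 1) := by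
    intro u
    rw [intervalIntegral.integral_comp_sub_left (fun x => |x| ^ p) u,
      intervalIntegral.integral_eq_sub_of_hasDerivAt
        (f := fun x => |x| ^ p * x / (p + 1)) (fun x _ => ?_) (hc.intervalIntegrable _ _)]
    · ring
    · have := (hasDerivAt_abs_rpow_mul_self hp x).div_const (p + 1)
      refine this.congr_deriv ?_
      field_simp
  have hderiv : ∀ x : ℝ, HasDerivAt (fun x : ℝ => |x| ^ (p + 2) / (p + 2)) (|x| ^ p * x) x := by
    intro x
    have := (hasDerivAt_abs_rpow x (by linarith : 1 < p + 2)).div_const (p + 2)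
    refine this.congr_deriv ?_
    rw [add_sub_cancel_right]
    field_simp
  simp only [hinner]
  rw [intervalIntegral.integral_eq_sub_of_hasDerivAt
    (f := fun u => (|u - t| ^ (p + 2) / (p + 2) - |u - (t + h)| ^ (p + 2) / (p + 2)) / (p + 1))
    (fun u _ => (((hderiv (u - t)).comp_sub_const u t).sub
      ((hderiv (u - (t + h))).comp_sub_const u (t + h))).div_const _) ?_]
  · have e1 : s + h - t = s - t + h := by ring
    have e2 : s + h - (t + h) = s - t := by ring
    have e3 : s - (t + h) = s - t - h := by ring
    rw [e1, e2, e3]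
    field_simp
    ring
  · refine Continuous.intervalIntegrable ?_ _ _
    have hc2 : Continuous fun x : ℝ => |x| ^ p * x := hc.mul continuous_id
    exact ((hc2.comp (continuous_sub_right t)).sub
      (hc2.comp (continuous_sub_right (t + h)))).div_const _

namespace IsFBM

variable {P : Measure Ω} {H : ℝ} {W : ℝ → Ω → ℝ}

lemma integral_sq (hW : IsFBM P H W) (hH : 0 < H) {t : ℝ} (ht : 0 ≤ t) :
    ∫ ω, W t ω ^ 2 ∂P = t ^ (2 * H) := by
  simp only [sq]
  rw [hW.cov t t ht ht, sub_self, abs_zero, Real.zero_rpow (by positivity)]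
  ring

lemma integral_abs_mul_le (hW : IsFBM P H W) (hH : 0 < H) {s t : ℝ} (hs : 0 ≤ s) (ht : 0 ≤ t) :
    ∫ ω, ‖W s ω * W t ω‖ ∂P ≤ s ^ (2 * H) + t ^ (2 * H) := by
  rw [← hW.integral_sq hH hs, ← hW.integral_sq hH ht,
    ← integral_add (hW.memLp_two hs).integrable_sq (hW.memLp_two ht).integrable_sq]
  refine integral_mono ((hW.memLp_two hs).integrable_mul (hW.memLp_two ht)).norm
    ((hW.memLp_two hs).integrable_sq.add (hW.memLp_two ht).integrable_sq) fun ω => ?_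
  simp only [Real.norm_eq_abs]
  rw [abs_le]
  constructor <;> nlinarith [sq_nonneg (W s ω + W t ω), sq_nonneg (W s ω - W t ω),
    sq_nonneg (W s ω), sq_nonneg (W t ω)]

lemma integral_nifBm_mul_eq_integral_integral [IsProbabilityMeasure P] (hW : IsFBM P H W)
    (hH : 0 < H) {h s t : ℝ} (hh : 0 < h) (hs : 0 ≤ s) (ht : 0 ≤ t) :
    ∫ ω, nifBm W h s ω * nifBm W h t ω ∂P
      = (1 / h) ^ 2 * ∫ u in s..(s + h), ∫ v in t..(t + h),
          (u ^ (2 * H) + v ^ (2 * H) - |u - v| ^ (2 * H)) / 2 := by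
  set ν₁ : Measure ℝ := volume.restrict (Set.Ioc s (s + h)) with hν₁
  set ν₂ : Measure ℝ := volume.restrict (Set.Ioc t (t + h)) with hν₂
  have hmem : ∀ᵐ p ∂(ν₁.prod ν₂), p ∈ Set.Ioc s (s + h) ×ˢ Set.Ioc t (t + h) := by
    rw [hν₁, hν₂, Measure.prod_restrict]
    exact ae_restrict_mem (measurableSet_Ioc.prod measurableSet_Ioc)
  have hm : Measurable fun q : Ω × ℝ × ℝ => W q.2.1 q.1 * W q.2.2 q.1 :=
    (hW.jointMeasurable.comp (measurable_snd.fst.prodMk measurable_fst)).mul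
      (hW.jointMeasurable.comp (measurable_snd.snd.prodMk measurable_fst))
  have hint : Integrable (fun q : Ω × ℝ × ℝ => W q.2.1 q.1 * W q.2.2 q.1)
      (P.prod (ν₁.prod ν₂)) := by
    rw [integrable_prod_iff' hm.aestronglyMeasurable]
    constructor
    · filter_upwards [hmem] with p hp
      exact (hW.memLp_two (hs.trans hp.1.1.le)).integrable_mul
        (hW.memLp_two (ht.trans hp.2.1.le))
    · refine Integrable.of_bound hm.norm.stronglyMeasurable.integral_prod_left'.aestronglyMeasurable
        ((s + h) ^ (2 * H) + (t + h) ^ (2 * H)) ?_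
      filter_upwards [hmem] with p hp
      rw [Real.norm_of_nonneg (integral_nonneg fun _ => norm_nonneg _)]
      refine (hW.integral_abs_mul_le hH (hs.trans hp.1.1.le) (ht.trans hp.2.1.le)).trans
        (add_le_add ?_ ?_)
      · exact Real.rpow_le_rpow (hs.trans hp.1.1.le) hp.1.2 (by positivity)
      · exact Real.rpow_le_rpow (ht.trans hp.2.1.le) hp.2.2 (by positivity)
  have hL : ∀ ω, nifBm W h s ω * nifBm W h t ω
      = (1 / h) ^ 2 * ∫ p, W p.1 ω * W p.2 ω ∂(ν₁.prod ν₂) := by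
    intro ω
    rw [integral_prod_mul (fun u => W u ω) fun v => W v ω, nifBm, nifBm,
      intervalIntegral.integral_of_le (by linarith), intervalIntegral.integral_of_le (by linarith)]
    ring
  simp only [hL]
  rw [integral_const_mul, integral_integral_swap hint]
  congr 1
  have hR : ∀ᵐ p ∂(ν₁.prod ν₂), ∫ ω, W p.1 ω * W p.2 ω ∂P
      = (p.1 ^ (2 * H) + p.2 ^ (2 * H) - |p.1 - p.2| ^ (2 * H)) / 2 := by
    filter_upwards [hmem] with p hp
    exact hW.cov _ _ (hs.trans hp.1.1.le) (ht.trans hp.2.1.le)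
  rw [integral_congr_ae hR, integral_prod _ (hint.integral_prod_right.congr hR),
    intervalIntegral.integral_of_le (by linarith)]
  simp only [intervalIntegral.integral_of_le (by linarith : t ≤ t + h), hν₁, hν₂]

/-- Covariance function of the nifBm. -/
lemma integral_nifBm_mul [IsProbabilityMeasure P] (hW : IsFBM P H W)
    (hH : 0 < H) {h s t : ℝ} (hh : 0 < h) (hs : 0 ≤ s) (ht : 0 ≤ t) :
    ∫ ω, nifBm W h s ω * nifBm W h t ω ∂P
      = (1 / h) ^ 2 / 2 * (h * (∫ u in s..(s + h), u ^ (2 * H))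
        + h * (∫ u in t..(t + h), u ^ (2 * H))
        - (|s - t + h| ^ (2 * H + 2) - 2 * |s - t| ^ (2 * H + 2) + |s - t - h| ^ (2 * H + 2))
          / ((2 * H + 1) * (2 * H + 2))) := by
  have hp : 0 < 2 * H := by positivity
  have hc1 : Continuous fun u : ℝ => u ^ (2 * H) :=
    continuous_id.rpow_const fun _ => Or.inr hp.le
  have hc2 : Continuous fun p : ℝ × ℝ => |p.1 - p.2| ^ (2 * H) :=
    (continuous_fst.sub continuous_snd).abs.rpow_const fun _ => Or.inr hp.le
  rw [hW.integral_nifBm_mul_eq_integral_integral hH hh hs ht,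
    ← integral_integral_abs_sub_rpow hp]
  have hinner : ∀ u, ∫ v in t..(t + h), (u ^ (2 * H) + v ^ (2 * H) - |u - v| ^ (2 * H)) / 2
      = (h * u ^ (2 * H) + (∫ v in t..(t + h), v ^ (2 * H))
        - ∫ v in t..(t + h), |u - v| ^ (2 * H)) / 2 := by
    intro u
    have hc3 : Continuous fun v : ℝ => |u - v| ^ (2 * H) := hc2.comp (Continuous.prodMk_right u)
    rw [intervalIntegral.integral_div, intervalIntegral.integral_sub
      ((by fun_prop : Continuous fun v : ℝ => u ^ (2 * H) + v ^ (2 * H)).intervalIntegrable _ _)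
      (hc3.intervalIntegrable _ _),
      intervalIntegral.integral_add (by simp) (hc1.intervalIntegrable _ _),
      intervalIntegral.integral_const]
    simp
  have hc4 : Continuous fun u : ℝ => ∫ v in t..(t + h), |u - v| ^ (2 * H) :=
    intervalIntegral.continuous_parametric_intervalIntegral_of_continuous' hc2 _ _
  simp only [hinner]
  rw [intervalIntegral.integral_div, intervalIntegral.integral_sub
      ((by fun_prop : Continuous fun u : ℝ => h * u ^ (2 * H)
        + ∫ v in t..(t + h), v ^ (2 * H)).intervalIntegrable _ _)
      (hc4.intervalIntegrable _ _),
    intervalIntegral.integral_add ((hc1.const_mul h).intervalIntegrable _ _) (by simp),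
    intervalIntegral.integral_const, intervalIntegral.integral_const_mul]
  simp only [add_sub_cancel_left, smul_eq_mul]
  ring

lemma memLp_two_nifBm [IsProbabilityMeasure P] (hW : IsFBM P H W) {h t : ℝ} (hh : 0 < h)
    (ht : 0 ≤ t) : MemLp (nifBm W h t) 2 P :=
  ((hW.isGaussianProcess_nifBm hh).1.hasGaussianLaw_eval ⟨t, ht⟩).memLp_two

lemma integral_nifBm_sq_le [IsProbabilityMeasure P] (hW : IsFBM P H W)
    (hH : 0 < H) {h t : ℝ} (hh : 0 < h) (ht : 0 ≤ t) :
    ∫ ω, nifBm W h t ω ^ 2 ∂P ≤ (t + h) ^ (2 * H) := by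
  have hp : 0 < 2 * H := by positivity
  have hc1 : Continuous fun u : ℝ => u ^ (2 * H) :=
    continuous_id.rpow_const fun _ => Or.inr hp.le
  have hI : ∫ u in t..(t + h), u ^ (2 * H) ≤ h * (t + h) ^ (2 * H) := by
    calc _ ≤ ∫ u in t..(t + h), (t + h) ^ (2 * H) :=
          intervalIntegral.integral_mono_on (by linarith) (hc1.intervalIntegrable _ _) (by simp)
            fun u hu => Real.rpow_le_rpow (ht.trans hu.1) hu.2 hp.le
      _ = _ := by simp
  simp only [sq]
  rw [hW.integral_nifBm_mul hH hh ht ht, sub_self, zero_add, zero_sub, abs_neg, abs_zero,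
    Real.zero_rpow (by positivity)]
  have h0 : 0 ≤ (|h| ^ (2 * H + 2) - 2 * 0 + |h| ^ (2 * H + 2))
      / ((2 * H + 1) * (2 * H + 2)) := by rw [mul_zero, sub_zero]; positivity
  calc _ ≤ (1 / h) ^ 2 / 2 * (2 * (h * (h * (t + h) ^ (2 * H)))) := by
        refine mul_le_mul_of_nonneg_left ?_ (by positivity)
        have := mul_le_mul_of_nonneg_left hI hh.le
        linarith
    _ = _ := by field_simp

end IsFBM

lemma gam_abs (H : ℝ) (n : ℤ) : gam H |n| = gam H n := by
  rcases abs_choice n with hn | hn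
  · rw [hn]
  · rw [hn, gam, gam]
    push_cast
    have e1 : |-(n : ℝ) - 2| = |(n : ℝ) + 2| := by rw [← abs_neg]; ring_nf
    have e2 : |-(n : ℝ) - 1| = |(n : ℝ) + 1| := by rw [← abs_neg]; ring_nf
    have e3 : |-(n : ℝ) + 1| = |(n : ℝ) - 1| := by rw [← abs_neg]; ring_nf
    have e4 : |-(n : ℝ) + 2| = |(n : ℝ) - 2| := by rw [← abs_neg]; ring_nf
    rw [e1, e2, e3, e4, abs_neg]
    ring

/-- The increments of the nifBm over the grid `h ℕ`. -/
def nifBmIncr (W : ℝ → Ω → ℝ) (h : ℝ) (k : ℕ) (ω : Ω) : ℝ :=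
  nifBm W h (((k : ℝ) + 1) * h) ω - nifBm W h ((k : ℝ) * h) ω

lemma memLp_two_nifBmIncr {P : Measure Ω} [IsProbabilityMeasure P] {H : ℝ} {W : ℝ → Ω → ℝ}
    (hW : IsFBM P H W) {h : ℝ} (hh : 0 < h) (k : ℕ) : MemLp (nifBmIncr W h k) 2 P :=
  (hW.memLp_two_nifBm hh (by positivity)).sub (hW.memLp_two_nifBm hh (by positivity))

/-- The increments of the nifBm have covariance `h ^ (2H) γ(H, |i - j|)`. -/
lemma integral_nifBmIncr_mul {P : Measure Ω} [IsProbabilityMeasure P] {H : ℝ} {W : ℝ → Ω → ℝ}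
    (hW : IsFBM P H W) (hH : 0 < H) {h : ℝ} (hh : 0 < h) (i j : ℕ) :
    ∫ ω, nifBmIncr W h i ω * nifBmIncr W h j ω ∂P
      = h ^ (2 * H) * gam H |(i : ℤ) - (j : ℤ)| := by
  have hm : ∀ k : ℕ, MemLp (nifBm W h ((k : ℝ) * h)) 2 P := fun k =>
    hW.memLp_two_nifBm hh (by positivity)
  have hm' : ∀ k : ℕ, MemLp (nifBm W h (((k : ℝ) + 1) * h)) 2 P := fun k =>
    hW.memLp_two_nifBm hh (by positivity)
  have hexp : ∀ ω, nifBmIncr W h i ω * nifBmIncr W h j ω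
      = (nifBm W h (((i : ℝ) + 1) * h) ω * nifBm W h (((j : ℝ) + 1) * h) ω
          - nifBm W h (((i : ℝ) + 1) * h) ω * nifBm W h ((j : ℝ) * h) ω)
        - (nifBm W h ((i : ℝ) * h) ω * nifBm W h (((j : ℝ) + 1) * h) ω
          - nifBm W h ((i : ℝ) * h) ω * nifBm W h ((j : ℝ) * h) ω) := by
    intro ω; simp only [nifBmIncr]; ring
  simp only [hexp]
  have i1 : Integrable (fun ω => nifBm W h (((i : ℝ) + 1) * h) ω
      * nifBm W h (((j : ℝ) + 1) * h) ω) P :=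
    (hm' i).integrable_mul (hm' j)
  have i2 : Integrable (fun ω => nifBm W h (((i : ℝ) + 1) * h) ω
      * nifBm W h ((j : ℝ) * h) ω) P :=
    (hm' i).integrable_mul (hm j)
  have i3 : Integrable (fun ω => nifBm W h ((i : ℝ) * h) ω
      * nifBm W h (((j : ℝ) + 1) * h) ω) P :=
    (hm i).integrable_mul (hm' j)
  have i4 : Integrable (fun ω => nifBm W h ((i : ℝ) * h) ω
      * nifBm W h ((j : ℝ) * h) ω) P :=
    (hm i).integrable_mul (hm j)
  have hpow : ∀ x : ℝ, |x * h| ^ (2 * H + 2) = |x| ^ (2 * H + 2) * (h ^ (2 * H) * h ^ 2) := by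
    intro x
    rw [abs_mul, abs_of_pos hh, Real.mul_rpow (abs_nonneg _) hh.le, Real.rpow_add hh]
    norm_cast
  rw [integral_sub (f := fun ω => nifBm W h (((i : ℝ) + 1) * h) ω * nifBm W h (((j : ℝ) + 1) * h) ω
          - nifBm W h (((i : ℝ) + 1) * h) ω * nifBm W h ((j : ℝ) * h) ω)
      (g := fun ω => nifBm W h ((i : ℝ) * h) ω * nifBm W h (((j : ℝ) + 1) * h) ω
          - nifBm W h ((i : ℝ) * h) ω * nifBm W h ((j : ℝ) * h) ω) (i1.sub i2) (i3.sub i4),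
    integral_sub i1 i2, integral_sub i3 i4,
    hW.integral_nifBm_mul hH hh (by positivity) (by positivity),
    hW.integral_nifBm_mul hH hh (by positivity) (by positivity),
    hW.integral_nifBm_mul hH hh (by positivity) (by positivity),
    hW.integral_nifBm_mul hH hh (by positivity) (by positivity), gam_abs, gam]
  push_cast
  set x : ℝ := (i : ℝ) - j with hx
  have a1 : ((i : ℝ) + 1) * h - ((j : ℝ) + 1) * h + h = (x + 1) * h := by rw [hx]; ring
  have a2 : ((i : ℝ) + 1) * h - ((j : ℝ) + 1) * h = x * h := by rw [hx]; ring
  have a3 : ((i : ℝ) + 1) * h - (j : ℝ) * h = (x + 1) * h := by rw [hx]; ring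
  have a4 : (i : ℝ) * h - ((j : ℝ) + 1) * h = (x - 1) * h := by rw [hx]; ring
  have a5 : (i : ℝ) * h - (j : ℝ) * h = x * h := by rw [hx]; ring
  have b1 : x * h - h = (x - 1) * h := by ring
  have b2 : x * h + h = (x + 1) * h := by ring
  have b3 : (x + 1) * h + h = (x + 2) * h := by ring
  have b4 : (x + 1) * h - h = x * h := by ring
  have b5 : (x - 1) * h - h = (x - 2) * h := by ring
  have b6 : (x - 1) * h + h = x * h := by ring
  rw [a2, a3, a4, a5, b1, b2, b3, b4, b5, b6]
  simp only [hpow]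
  field_simp
  ring

lemma integral_nifBm_sub_sq_le {P : Measure Ω} [IsProbabilityMeasure P] {H : ℝ} {W : ℝ → Ω → ℝ}
    (hW : IsFBM P H W) (hH : 0 < H) {h t : ℝ} (hh : 0 < h) (ht : 0 ≤ t) :
    ∫ ω, (nifBm W h t ω - nifBm W h 0 ω) ^ 2 ∂P ≤ 4 * (t + h) ^ (2 * H) := by
  have m1 := hW.memLp_two_nifBm hh ht
  have m2 := hW.memLp_two_nifBm hh le_rfl
  calc _ ≤ ∫ ω, (2 * nifBm W h t ω ^ 2 + 2 * nifBm W h 0 ω ^ 2) ∂P :=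
        integral_mono (m1.sub m2).integrable_sq
          ((m1.integrable_sq.const_mul 2).add (m2.integrable_sq.const_mul 2)) fun ω => by
            simp only [Pi.sub_apply]
            nlinarith [sq_nonneg (nifBm W h t ω + nifBm W h 0 ω)]
    _ = 2 * ∫ ω, nifBm W h t ω ^ 2 ∂P + 2 * ∫ ω, nifBm W h 0 ω ^ 2 ∂P := by
        rw [integral_add (m1.integrable_sq.const_mul 2) (m2.integrable_sq.const_mul 2),
          integral_const_mul, integral_const_mul]
    _ ≤ 2 * (t + h) ^ (2 * H) + 2 * (t + h) ^ (2 * H) := by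
        have h1 := hW.integral_nifBm_sq_le hH hh ht
        have h2 := hW.integral_nifBm_sq_le hH hh le_rfl
        have h3 : (0 + h) ^ (2 * H) ≤ (t + h) ^ (2 * H) :=
          Real.rpow_le_rpow (by linarith) (by linarith) (by positivity)
        linarith
    _ = _ := by ring

section Estimator

variable {P : Measure Ω} [IsProbabilityMeasure P] {H : ℝ} {W : ℝ → Ω → ℝ}

lemma isGaussianProcess_nifBmIncr (hW : IsFBM P H W) {h : ℝ} (hh : 0 < h) :
    IsGaussianProcess (nifBmIncr W h) P := by
  classical
  let τ : ℕ → NNReal := fun k => k * ⟨h, hh.le⟩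
  have hτ : ∀ k : ℕ, (τ k : ℝ) = k * h := fun _ => rfl
  refine IsGaussianProcess.of_isGaussianProcess (hW.isGaussianProcess_nifBm hh).1 fun k => ?_
  refine ⟨{τ k, τ (k + 1)}, ContinuousLinearMap.proj ⟨τ (k + 1), by simp⟩
    - ContinuousLinearMap.proj ⟨τ k, by simp⟩, fun ω => ?_⟩
  simp [nifBmIncr, hτ]

lemma integral_nifBmIncr (hW : IsFBM P H W) {h : ℝ} (hh : 0 < h) (k : ℕ) :
    ∫ ω, nifBmIncr W h k ω ∂P = 0 := by
  have hX : ∀ t : ℝ, 0 ≤ t → ∫ ω, nifBm W h t ω ∂P = 0 := fun t ht =>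
    (hW.isGaussianProcess_nifBm hh).2 ⟨t, ht⟩
  unfold nifBmIncr
  rw [integral_sub ((hW.memLp_two_nifBm hh (by positivity)).integrable one_le_two)
    ((hW.memLp_two_nifBm hh (by positivity)).integrable one_le_two),
    hX _ (by positivity), hX _ (by positivity), sub_zero]

/-- The second moment of two linear combinations of nifBm increments, the first one using no more
increments than the second one. -/
lemma integral_sum_nifBmIncr_mul (hW : IsFBM P H W) (hH : 0 < H) {h : ℝ} (hh : 0 < h)
    {n m : ℕ} (hnm : n ≤ m) (u : Fin n → ℝ) (v : Fin m → ℝ) :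
    ∫ ω, (∑ i, u i * nifBmIncr W h i ω) * (∑ j, v j * nifBmIncr W h j ω) ∂P
      = ∑ i, u i * (covMat1 h H m *ᵥ v) (Fin.castLE hnm i) := by
  have hint : ∀ (i : Fin n) (j : Fin m), Integrable
      (fun ω => u i * v j * (nifBmIncr W h i ω * nifBmIncr W h j ω)) P := fun i j =>
    ((memLp_two_nifBmIncr hW hh i).integrable_mul (memLp_two_nifBmIncr hW hh j)).const_mul _
  have hexp : ∀ ω, (∑ i, u i * nifBmIncr W h i ω) * (∑ j, v j * nifBmIncr W h j ω)
      = ∑ i, ∑ j, u i * v j * (nifBmIncr W h i ω * nifBmIncr W h j ω) := fun ω => by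
    rw [Finset.sum_mul_sum]
    exact Finset.sum_congr rfl fun i _ => Finset.sum_congr rfl fun j _ => by ring
  simp only [hexp]
  rw [integral_finsetSum _ fun i _ => integrable_finsetSum _ fun j _ => hint i j]
  refine Finset.sum_congr rfl fun i _ => ?_
  rw [integral_finsetSum _ fun j _ => hint i j, mulVec, dotProduct, Finset.mul_sum]
  refine Finset.sum_congr rfl fun j _ => ?_
  rw [integral_const_mul, integral_nifBmIncr_mul hW hH hh, covMat1, Matrix.of_apply]
  simp only [Fin.val_castLE]
  ring

/-- The Fisher information of the drift for unit noise intensity. -/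
def fisherInfo1 (h H : ℝ) (G : ℝ → ℝ) (N : ℕ) : ℝ :=
  deltaGvec G h N ⬝ᵥ ((covMat1 h H N)⁻¹ *ᵥ deltaGvec G h N)

/-- The weights expressing the estimation error through the nifBm increments. -/
def errorWeight1 (a h H : ℝ) (G : ℝ → ℝ) (N : ℕ) : Fin N → ℝ :=
  (a / fisherInfo1 h H G N) • ((covMat1 h H N)⁻¹ *ᵥ deltaGvec G h N)

lemma fisherInfo1_pos {h : ℝ} (hh : 0 < h) (hH : H ∈ Set.Ioo (0 : ℝ) 1) {G : ℝ → ℝ} {N : ℕ}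
    (hG : deltaGvec G h N ≠ 0) : 0 < fisherInfo1 h H G N := by
  simpa [fisherInfo1] using (covMat1_posDef hh hH N).inv.dotProduct_mulVec_pos hG

lemma deltaGvec_dotProduct_errorWeight1 (a : ℝ) {h : ℝ} {G : ℝ → ℝ} {N : ℕ}
    (hI : fisherInfo1 h H G N ≠ 0) : deltaGvec G h N ⬝ᵥ errorWeight1 a h H G N = a := by
  rw [errorWeight1, dotProduct_smul, smul_eq_mul]
  change a / fisherInfo1 h H G N * fisherInfo1 h H G N = a
  field_simp

lemma covMat1_mulVec_errorWeight1 (a : ℝ) {h : ℝ} (hh : 0 < h) (hH : H ∈ Set.Ioo (0 : ℝ) 1)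
    (G : ℝ → ℝ) (N : ℕ) :
    covMat1 h H N *ᵥ errorWeight1 a h H G N = (a / fisherInfo1 h H G N) • deltaGvec G h N := by
  rw [errorWeight1, mulVec_smul, mulVec_mulVec,
    mul_nonsing_inv _ (covMat1_posDef hh hH N).det_pos.ne'.isUnit, one_mulVec]

/-- The estimation error is a linear combination of the nifBm increments. -/
lemma muHat1_eq {Ω' : Type*} {W : ℝ → Ω' → ℝ} (a μ : ℝ) {h : ℝ} (hh : 0 < h) 
    (hH : H ∈ Set.Ioo (0 : ℝ) 1) {G : ℝ → ℝ} {N : ℕ} (hG : deltaGvec G h N ≠ 0) (ω : Ω') :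
    muHat1 W a h H μ G N ω = ∑ i, errorWeight1 a h H G N i * nifBmIncr W h i ω + μ := by
  have hI := (fisherInfo1_pos hh hH hG).ne'
  have hY : deltaYvec1 W a h μ G N ω
      = μ • deltaGvec G h N + a • fun i : Fin N => nifBmIncr W h i ω := by
    funext i
    simp only [deltaYvec1, Yobs1, deltaGvec, nifBmIncr, Pi.add_apply, Pi.smul_apply, smul_eq_mul]
    push_cast
    ring
  have hT : ((covMat1 h H N)⁻¹)ᵀ = (covMat1 h H N)⁻¹ := by
    simpa [IsHermitian] using (covMat1_posDef hh hH N).inv.isHermitian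
  have hsum : ∑ i, errorWeight1 a h H G N i * nifBmIncr W h i ω
      = a / fisherInfo1 h H G N * (deltaGvec G h N ⬝ᵥ
        ((covMat1 h H N)⁻¹ *ᵥ fun i : Fin N => nifBmIncr W h i ω)) := by
    rw [dotProduct_mulVec, ← mulVec_transpose, hT, ← smul_eq_mul, ← smul_dotProduct]
    rfl
  rw [hsum, muHat1, hY, mulVec_add, mulVec_smul, mulVec_smul, dotProduct_add, dotProduct_smul,
    dotProduct_smul]
  change (μ • fisherInfo1 h H G N + _) / fisherInfo1 h H G N = _
  simp only [smul_eq_mul]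
  field_simp
  ring

lemma integral_errorSum_mul (hW : IsFBM P H W) (a : ℝ) {h : ℝ} (hh : 0 < h)
    (hH : H ∈ Set.Ioo (0 : ℝ) 1) {G : ℝ → ℝ} {n m : ℕ} (hnm : n ≤ m) (u : Fin n → ℝ) :
    ∫ ω, (∑ i, u i * nifBmIncr W h i ω)
        * (∑ j, errorWeight1 a h H G m j * nifBmIncr W h j ω) ∂P
      = a / fisherInfo1 h H G m * (deltaGvec G h n ⬝ᵥ u) := by
  rw [integral_sum_nifBmIncr_mul hW hH.1 hh hnm, covMat1_mulVec_errorWeight1 a hh hH,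
    dotProduct, Finset.mul_sum]
  refine Finset.sum_congr rfl fun i _ => ?_
  simp only [Pi.smul_apply, smul_eq_mul, deltaGvec, Fin.val_castLE]
  ring

lemma isGaussianProcess_errorSum (hW : IsFBM P H W) {h : ℝ} (hh : 0 < h)
    (w : (N : ℕ) → Fin N → ℝ) :
    IsGaussianProcess (fun N ω => ∑ i, w N i * nifBmIncr W h i ω) P := by
  refine IsGaussianProcess.of_isGaussianProcess (isGaussianProcess_nifBmIncr hW hh) fun N => ?_
  refine ⟨Finset.range N, ∑ i, w N i • ContinuousLinearMap.proj
    ⟨(i : ℕ), Finset.mem_range.2 i.2⟩, fun ω => ?_⟩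
  simp

lemma memLp_two_errorSum (hW : IsFBM P H W) {h : ℝ} (hh : 0 < h) {N : ℕ} (w : Fin N → ℝ) :
    MemLp (fun ω => ∑ i, w i * nifBmIncr W h i ω) 2 P :=
  memLp_finsetSum _ fun i _ => (memLp_two_nifBmIncr hW hh i).const_mul _

lemma integral_errorSum (hW : IsFBM P H W) {h : ℝ} (hh : 0 < h) {N : ℕ} (w : Fin N → ℝ) :
    ∫ ω, ∑ i, w i * nifBmIncr W h i ω ∂P = 0 := by
  have hint : ∀ i : Fin N, Integrable (fun ω => w i * nifBmIncr W h i ω) P := fun i =>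
    ((memLp_two_nifBmIncr hW hh i).integrable one_le_two).const_mul _
  rw [integral_finsetSum _ fun i _ => hint i]
  simp [integral_const_mul, integral_nifBmIncr hW hh]

/-- Lower bound for the Fisher information in terms of the drift at the last observation time. -/
lemma sq_div_fisherInfo1_le (hW : IsFBM P H W) {h : ℝ} (hh : 0 < h)
    (hH : H ∈ Set.Ioo (0 : ℝ) 1) {G : ℝ → ℝ} (hG0 : G 0 = 0) {N : ℕ}
    (hG : deltaGvec G h N ≠ 0) :
    G (N * h) ^ 2 / fisherInfo1 h H G N ≤ 4 * (N * h + h) ^ (2 * H) := by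
  have hI := (fisherInfo1_pos hh hH hG).ne'
  set w := errorWeight1 1 h H G N with hw
  have hD : ∀ ω, nifBm W h (N * h) ω - nifBm W h 0 ω
      = ∑ i : Fin N, (1 : ℝ) * nifBmIncr W h i ω := by
    intro ω
    simp only [one_mul]
    rw [Fin.sum_univ_eq_sum_range (fun k => nifBmIncr W h k ω)]
    have := Finset.sum_range_sub (fun k : ℕ => nifBm W h (k * h) ω) N
    push_cast at this
    rw [zero_mul] at this
    exact this.symm
  have hGsum : deltaGvec G h N ⬝ᵥ (fun _ => (1 : ℝ)) = G (N * h) := by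
    simp only [dotProduct, deltaGvec, mul_one]
    rw [Fin.sum_univ_eq_sum_range (fun k : ℕ => G (((k : ℝ) + 1) * h) - G ((k : ℝ) * h))]
    have := Finset.sum_range_sub (fun k : ℕ => G (k * h)) N
    push_cast at this
    rw [zero_mul, hG0, sub_zero] at this
    exact this
  have m1 : MemLp (fun ω => ∑ i : Fin N, (1 : ℝ) * nifBmIncr W h i ω) 2 P :=
    memLp_two_errorSum hW hh fun _ => 1
  have m2 : MemLp (fun ω => ∑ i, w i * nifBmIncr W h i ω) 2 P := memLp_two_errorSum hW hh w
  have hcross := integral_errorSum_mul hW 1 hh hH (G := G) (le_refl N) fun _ => (1 : ℝ)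
  have hsq := integral_errorSum_mul hW 1 hh hH (G := G) (le_refl N) w
  rw [hGsum] at hcross
  rw [hw, deltaGvec_dotProduct_errorWeight1 1 hI, ← hw] at hsq
  rw [← hw] at hcross
  have hbound := integral_nifBm_sub_sq_le hW hH.1 hh (by positivity : (0 : ℝ) ≤ N * h)
  simp only [hD] at hbound
  have hnn : 0 ≤ ∫ ω, (∑ i : Fin N, (1 : ℝ) * nifBmIncr W h i ω
      - G (N * h) * ∑ i, w i * nifBmIncr W h i ω) ^ 2 ∂P := integral_nonneg fun _ => sq_nonneg _
  have hexp : ∀ ω, (∑ i : Fin N, (1 : ℝ) * nifBmIncr W h i ω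
      - G (N * h) * ∑ i, w i * nifBmIncr W h i ω) ^ 2
      = (∑ i : Fin N, (1 : ℝ) * nifBmIncr W h i ω) ^ 2
        - ((2 * G (N * h)) * ((∑ i : Fin N, (1 : ℝ) * nifBmIncr W h i ω)
          * ∑ i, w i * nifBmIncr W h i ω)
        - G (N * h) ^ 2 * ((∑ i, w i * nifBmIncr W h i ω)
          * ∑ i, w i * nifBmIncr W h i ω)) := fun ω => by ring
  simp only [hexp] at hnn
  have i1 : Integrable (fun ω => (2 * G (N * h)) * ((∑ i : Fin N, (1 : ℝ) * nifBmIncr W h i ω)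
      * ∑ i, w i * nifBmIncr W h i ω)) P := (m1.integrable_mul m2).const_mul _
  have i2 : Integrable (fun ω => G (N * h) ^ 2 * ((∑ i, w i * nifBmIncr W h i ω)
      * ∑ i, w i * nifBmIncr W h i ω)) P := (m2.integrable_mul m2).const_mul _
  rw [integral_sub m1.integrable_sq (i1.sub' i2), integral_sub i1 i2,
    integral_const_mul, integral_const_mul, hcross, hsq] at hnn
  have : G (N * h) ^ 2 / fisherInfo1 h H G N
      = 2 * G (N * h) * (1 / fisherInfo1 h H G N * G (N * h))
        - G (N * h) ^ 2 * (1 / fisherInfo1 h H G N * 1) := by ring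
  linarith

lemma tendsto_inv_fisherInfo1 (hW : IsFBM P H W) {h : ℝ} (hh : 0 < h)
    (hH : H ∈ Set.Ioo (0 : ℝ) 1) {G : ℝ → ℝ} (hG0 : G 0 = 0)
    (hG : ∀ N : ℕ, 1 ≤ N → deltaGvec G h N ≠ 0)
    (hlim : Tendsto (fun N : ℕ => |G ((N : ℝ) * h)| / (N : ℝ) ^ H) atTop atTop) :
    Tendsto (fun N => 1 / fisherInfo1 h H G N) atTop (𝓝 0) := by
  have hz : Tendsto (fun N : ℕ => 4 * (2 * h) ^ (2 * H)
      * ((|G ((N : ℝ) * h)| / (N : ℝ) ^ H)⁻¹) ^ 2) atTop (𝓝 0) := by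
    simpa using (hlim.inv_tendsto_atTop.pow 2).const_mul (4 * (2 * h) ^ (2 * H))
  refine tendsto_of_tendsto_of_tendsto_of_le_of_le' tendsto_const_nhds hz ?_ ?_
  · filter_upwards [eventually_ge_atTop 1] with N hN
    exact (one_div_pos.2 (fisherInfo1_pos hh hH (hG N hN))).le
  · filter_upwards [eventually_ge_atTop 1, hlim.eventually_gt_atTop 0] with N hN hpos
    have hN1 : (1 : ℝ) ≤ N := by exact_mod_cast hN
    have hNH : 0 < (N : ℝ) ^ H := by positivity
    have hGpos : 0 < |G (N * h)| := by
      by_contra hneg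
      rw [le_antisymm (not_lt.1 hneg) (abs_nonneg _), zero_div] at hpos
      exact hpos.false
    have hpow : (N * h + h) ^ (2 * H) ≤ (2 * h) ^ (2 * H) * ((N : ℝ) ^ H) ^ 2 := by
      calc (N * h + h) ^ (2 * H) ≤ (2 * h * N) ^ (2 * H) :=
            Real.rpow_le_rpow (by positivity) (by nlinarith) (by linarith [hH.1])
        _ = _ := by
            rw [Real.mul_rpow (by positivity) (by positivity), mul_comm 2 H,
              Real.rpow_mul (by positivity : (0 : ℝ) ≤ N)]
            norm_cast
    have hle := sq_div_fisherInfo1_le hW hh hH hG0 (hG N hN)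
    rw [inv_div, div_pow, sq_abs, ← mul_div_assoc, le_div_iff₀ (by rw [← sq_abs]; positivity),
      one_div_mul_eq_div]
    calc _ ≤ _ := hle
      _ ≤ 4 * ((2 * h) ^ (2 * H) * ((N : ℝ) ^ H) ^ 2) := by linarith
      _ = _ := by ring

end Estimator

/-- In the one-nifBm model with drift: (1) for every `N` with
`ΔG^{(N)} ≠ 0`, `μ̂_N` is unbiased and normal with mean `μ` and variance
`a²/((ΔG)ᵀ (Σ_H)⁻¹ ΔG)`; (2) if `N^H/G(Nh) → 0` (i.e. `|G(Nh)|/N^H → ∞`), then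
`μ̂_N → μ` in `L²(P)` and almost surely. -/
theorem drift_mle_one_nifBm
    (P : Measure Ω) [IsProbabilityMeasure P]
    (H : ℝ) (hH : H ∈ Set.Ioo (0:ℝ) 1)
    (W : ℝ → Ω → ℝ) (hW : IsFBM P H W)
    (a : ℝ) (ha : a ≠ 0) (h : ℝ) (hh : 0 < h)
    (μ : ℝ) (G : ℝ → ℝ) (hG0 : G 0 = 0)
    (hΔG : ∀ N : ℕ, 1 ≤ N → deltaGvec G h N ≠ 0) :
    (∀ N : ℕ, 1 ≤ N →
      (∫ ω, muHat1 W a h H μ G N ω ∂P = μ ∧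
       P.map (muHat1 W a h H μ G N)
         = gaussianReal μ (Real.toNNReal
             (a^2 / (deltaGvec G h N ⬝ᵥ ((covMat1 h H N)⁻¹ *ᵥ deltaGvec G h N)))))) ∧
    (Tendsto (fun N : ℕ => |G ((N:ℝ)*h)| / (N:ℝ) ^ H) atTop atTop →
      Tendsto (fun N : ℕ => ∫ ω, (muHat1 W a h H μ G N ω - μ)^2 ∂P) atTop (𝓝 0) ∧
      ∀ᵐ ω ∂P, Tendsto (fun N : ℕ => muHat1 W a h H μ G N ω) atTop (𝓝 μ)) := by
  have hdiff : ∀ N : ℕ, 1 ≤ N → ∀ ω, muHat1 W a h H μ G N ω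
      = ∑ i, errorWeight1 a h H G N i * nifBmIncr W h i ω + μ := fun N hN ω =>
    muHat1_eq a μ hh hH (hΔG N hN) ω
  have hcov : ∀ n m : ℕ, 1 ≤ n → n ≤ m →
      ∫ ω, (∑ i, errorWeight1 a h H G n i * nifBmIncr W h i ω)
        * (∑ j, errorWeight1 a h H G m j * nifBmIncr W h j ω) ∂P
        = a ^ 2 * (1 / fisherInfo1 h H G m) := by
    intro n m hn hnm
    rw [integral_errorSum_mul hW a hh hH hnm, deltaGvec_dotProduct_errorWeight1 a
      (fisherInfo1_pos hh hH (hΔG n hn)).ne']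
    ring
  have hgauss := isGaussianProcess_errorSum hW hh (errorWeight1 a h H G)
  refine ⟨fun N hN => ?_, fun hlim => ?_⟩
  · have hL2 := memLp_two_errorSum hW hh (errorWeight1 a h H G N)
    have hvar := hcov N N hN le_rfl
    constructor
    · simp only [hdiff N hN]
      rw [integral_add (hL2.integrable one_le_two) (integrable_const _), integral_errorSum hW hh]
      simp
    · have hmap := (hgauss.hasGaussianLaw_eval N).map_eq_gaussianReal
      rw [integral_errorSum hW hh, variance_of_integral_eq_zero hL2.aemeasurable
        (integral_errorSum hW hh _)] at hmap
      simp only [sq (∑ i, errorWeight1 a h H G N i * nifBmIncr W h i _), hvar] at hmap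
      have hadd := gaussianReal_map_add_const (μ := 0)
        (v := (a ^ 2 * (1 / fisherInfo1 h H G N)).toNNReal) μ
      rw [← hmap, AEMeasurable.map_map_of_aemeasurable (by fun_prop) hL2.aemeasurable,
        zero_add, mul_one_div] at hadd
      change _ = gaussianReal μ (a ^ 2 / fisherInfo1 h H G N).toNNReal
      rw [← hadd]
      congr 1
      exact funext (hdiff N hN)
  · have hV : Tendsto (fun N => a ^ 2 * (1 / fisherInfo1 h H G N)) atTop (𝓝 0) := by
      simpa using (tendsto_inv_fisherInfo1 hW hh hH hG0 hΔG hlim).const_mul (a ^ 2)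
    constructor
    · refine hV.congr' ?_
      filter_upwards [eventually_ge_atTop 1] with N hN
      simp only [hdiff N hN, add_sub_cancel_right, sq (∑ i, _)]
      exact (hcov N N hN le_rfl).symm
    · have hmeas : ∀ n, StronglyMeasurable fun ω =>
          ∑ i, errorWeight1 a h H G (n + 1) i * nifBmIncr W h i ω := fun n =>
        Finset.stronglyMeasurable_fun_sum _ fun i _ =>
          ((hW.stronglyMeasurable_nifBm h _).sub (hW.stronglyMeasurable_nifBm h _)).const_mul _
      have hae := ae_tendsto_zero_of_covariance_max (hgauss.comp_right fun n => n + 1) hmeas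
        (fun n => integral_errorSum hW hh _)
        (fun i j hij => hcov (i + 1) (j + 1) (by omega) (by omega))
        ((tendsto_add_atTop_iff_nat 1).2 hV)
      filter_upwards [hae] with ω hω
      rw [← tendsto_add_atTop_iff_nat 1]
      simp only [fun n : ℕ => hdiff (n + 1) (by omega) ω]
      simpa using hω.add_const μ
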